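/- With the setup below (u built from 𝐢₀ and z, u₁ the twisted matrix, b := u₁·d·w̄₀·u₂ lower triangular and invertible), write b = [b]_−·t_R with [b]_− lower triangular with unit diagonal and t_R the invertible diagonal matrix of diagonal entries of b. Then t_R = w̄₀·d·[u]₀·w̄₀⁻¹, where [u]₀ is the diagonal matrix whose entries are the diagonal entries of u; equivalently, b_{n+1−j, n+1−j} = d_{jj}·u_{jj} for every 1 ≤ j ≤ n. -/

import Mathlib

open Matrix

/-- `yMat n 𝕂 i z` is the n×n identity matrix except entry (i+1, i) (1-based) equals `z`. -/
def yMat (n : ℕ) (𝕂 : Type*) [Field 𝕂] (i : ℕ) (z : 𝕂) :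
    Matrix (Fin n) (Fin n) 𝕂 :=
  fun a b => if a = b then 1 else if (a : ℕ) = i ∧ (b : ℕ) + 1 = i then z else 0

/-- `xMat n 𝕂 i z` is the n×n identity matrix except entry (i, i+1) (1-based) equals `z`. -/
def xMat (n : ℕ) (𝕂 : Type*) [Field 𝕂] (i : ℕ) (z : 𝕂) :
    Matrix (Fin n) (Fin n) 𝕂 :=
  fun a b => if a = b then 1 else if (a : ℕ) + 1 = i ∧ (b : ℕ) = i then z else 0

/-- `xNegMat n 𝕂 i z` is the identity except the 2×2 block in rows/cols i, i+1 (1-based)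
equals [[z⁻¹, 0], [1, z]]. -/
noncomputable def xNegMat (n : ℕ) (𝕂 : Type*) [Field 𝕂] (i : ℕ) (z : 𝕂) :
    Matrix (Fin n) (Fin n) 𝕂 :=
  fun a b =>
    if (a : ℕ) + 1 = i ∧ (b : ℕ) + 1 = i then z⁻¹
    else if (a : ℕ) = i ∧ (b : ℕ) = i then z
    else if (a : ℕ) = i ∧ (b : ℕ) + 1 = i then 1
    else if a = b then 1 else 0

/-- The matrix w̄₀ with (i, n+1−i) entry (−1)^(n−i) (1-based) and other entries 0. -/
def w0bar (n : ℕ) (𝕂 : Type*) [Field 𝕂] : Matrix (Fin n) (Fin n) 𝕂 :=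
  fun a b => if (a : ℕ) + (b : ℕ) = n - 1 then (-1 : 𝕂) ^ (n - 1 - (a : ℕ)) else 0

/-- s_k = Σ_{j=1}^{k−1} (n−j). -/
def sIdx (n k : ℕ) : ℕ := ∑ j ∈ Finset.Icc 1 (k - 1), (n - j)

/-- The word 𝐢₀ = (1,2,…,n−1, 1,2,…,n−2, …, 1,2, 1). -/
def wordI0 (n : ℕ) : List ℕ :=
  (List.range (n - 1)).flatMap (fun k => (List.range (n - 1 - k)).map (· + 1))

/-- The word 𝐢′₀ = (n−1,…,1, n−1,…,2, …, n−1,n−2, n−1). -/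
def wordI0' (n : ℕ) : List ℕ :=
  (List.range (n - 1)).flatMap (fun k => (List.range (n - 1 - k)).map (fun a => n - 1 - a))

/-- The simple reflection s_i = (i, i+1) (1-based) as a permutation of `Fin n`. -/
def sPerm (n i : ℕ) : Equiv.Perm (Fin n) :=
  if h : 1 ≤ i ∧ i < n then Equiv.swap ⟨i - 1, by omega⟩ ⟨i, h.2⟩ else 1

/-- The longest element of S_n, k ↦ n+1−k (1-based). -/
def w0Perm (n : ℕ) : Equiv.Perm (Fin n) where
  toFun a := ⟨n - 1 - (a : ℕ), by have := a.isLt; omega⟩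
  invFun a := ⟨n - 1 - (a : ℕ), by have := a.isLt; omega⟩
  left_inv a := by
    have := a.isLt
    apply Fin.ext
    show n - 1 - (n - 1 - (a : ℕ)) = (a : ℕ)
    omega
  right_inv a := by
    have := a.isLt
    apply Fin.ext
    show n - 1 - (n - 1 - (a : ℕ)) = (a : ℕ)
    omega

/-- Apply a permutation of `Fin n` to a 1-based label in {1, …, n}. -/
def permApp {n : ℕ} (σ : Equiv.Perm (Fin n)) (x : ℕ) : ℕ :=
  if h : 1 ≤ x ∧ x ≤ n then ((σ ⟨x - 1, by omega⟩ : Fin n) : ℕ) + 1 else x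

section Submatrix

variable {R l m n o p : Type*} [CommRing R] [Fintype n] [Fintype o]

/-- A submatrix of a product is a product of submatrices when the omitted inner indices
contribute nothing. -/
theorem Matrix.submatrix_mul_of_injective (A : Matrix m n R) (B : Matrix n p R)
    {r : l → m} {e : o → n} {s : l → p} (he : Function.Injective e)
    (h : ∀ i j, ∀ c ∉ Set.range e, A (r i) c * B c (s j) = 0) :
    (A * B).submatrix r s = A.submatrix r e * B.submatrix e s := by
  ext i j
  simp only [submatrix_apply, mul_apply]
  exact (Fintype.sum_of_injective e he _ _ (h i j) fun _ => rfl).symm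

end Submatrix

section Triangular

variable {R : Type*} [CommRing R] {n : ℕ}

theorem Matrix.BlockTriangular.mul_apply_diag {α : Type*} [LinearOrder α] {f : Fin n → α}
    {A B : Matrix (Fin n) (Fin n) R} (hf : Function.Injective f) (hA : A.BlockTriangular f)
    (hB : B.BlockTriangular f) (i : Fin n) : (A * B) i i = A i i * B i i := by
  rw [mul_apply]
  refine Finset.sum_eq_single i (fun c _ hc => ?_) (by simp)
  rcases lt_or_gt_of_ne (hf.ne hc) with h | h
  · rw [hA h, zero_mul]
  · rw [hB h, mul_zero]

/-- The diagonal of an upper triangular matrix factored as upper triangular times lower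
triangular. -/
theorem Matrix.BlockTriangular.mul_lower_apply_diag {A B : Matrix (Fin n) (Fin n) R}
    (hAB : (A * B).BlockTriangular id) (hA : A.BlockTriangular id) (hdet : IsUnit A.det)
    (i : Fin n) : (A * B) i i = A i i * B i i := by
  have : Invertible A := A.invertibleOfIsUnitDet hdet
  have hB : B.BlockTriangular id := by
    rw [← nonsing_inv_mul_cancel_left A B hdet]
    exact (blockTriangular_inv_of_blockTriangular hA).mul hAB
  exact hA.mul_apply_diag Function.injective_id hB i

/-- The square submatrix in the last `k` rows and the first `k` columns. -/
def Matrix.lowerLeft (A : Matrix (Fin n) (Fin n) R) {k : ℕ} (hk : k ≤ n) :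
    Matrix (Fin k) (Fin k) R :=
  A.submatrix (fun i => (Fin.castLE hk i.rev).rev) (Fin.castLE hk)

theorem Matrix.det_lowerLeft_upper_mul {A : Matrix (Fin n) (Fin n) R}
    (hA : A.BlockTriangular id) (hdiag : ∀ i, A i i = 1) (B : Matrix (Fin n) (Fin n) R)
    {k : ℕ} (hk : k ≤ n) : ((A * B).lowerLeft hk).det = (B.lowerLeft hk).det := by
  have hinj : Function.Injective fun i : Fin k => (Fin.castLE hk i.rev).rev := fun i j h => by
    simpa using h
  rw [lowerLeft, submatrix_mul_of_injective A B hinj, det_mul, det_of_isUpperTriangular]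
  · simp [hdiag, lowerLeft]
  · intro i j hij
    apply hA
    simp only [id, Fin.lt_def, Fin.val_rev, Fin.val_castLE] at hij ⊢
    omega
  · intro i j c hc
    rw [hA, zero_mul]
    by_contra hlt
    apply hc
    simp only [id, Fin.lt_def, Fin.val_rev, Fin.val_castLE] at hlt
    refine ⟨⟨c - (n - k), by omega⟩, ?_⟩
    ext
    simp only [Fin.val_rev, Fin.val_castLE]
    omega

theorem Matrix.det_lowerLeft_mul_upper (A : Matrix (Fin n) (Fin n) R)
    {B : Matrix (Fin n) (Fin n) R} (hB : B.BlockTriangular id) {k : ℕ} (hk : k ≤ n) :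
    ((A * B).lowerLeft hk).det
      = (A.lowerLeft hk).det * ∏ i : Fin k, B (Fin.castLE hk i) (Fin.castLE hk i) := by
  rw [lowerLeft, submatrix_mul_of_injective A B (Fin.castLE_injective hk), det_mul,
    det_of_isUpperTriangular (M := B.submatrix _ _)]
  · simp [lowerLeft]
  · intro i j hij
    exact hB hij
  · intro i j c hc
    rw [hB, mul_zero]
    by_contra hlt
    apply hc
    simp only [id, Fin.lt_def, Fin.val_castLE] at hlt
    exact ⟨⟨c, by omega⟩, rfl⟩

end Triangular

section Longest

variable {𝕂 : Type*} [Field 𝕂]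

theorem w0bar_apply (n : ℕ) (a b : Fin n) :
    w0bar n 𝕂 a b = if b = a.rev then (-1) ^ (n - 1 - (a : ℕ)) else 0 := by
  have : (a : ℕ) + b = n - 1 ↔ b = a.rev := by
    rw [Fin.ext_iff, Fin.val_rev]
    omega
  simp [w0bar, this]

theorem neg_one_pow_mul_self (k : ℕ) : ((-1) ^ k * (-1) ^ k : 𝕂) = 1 := by
  rw [← mul_pow]
  simp

theorem w0bar_conj_apply {n : ℕ} (M : Matrix (Fin n) (Fin n) 𝕂) (a b : Fin n) :
    (w0bar n 𝕂 * M * (w0bar n 𝕂)ᵀ) a b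
      = (-1) ^ (n - 1 - (a : ℕ)) * M a.rev b.rev * (-1) ^ (n - 1 - (b : ℕ)) := by
  simp [mul_apply, w0bar_apply]

theorem w0bar_conj_apply_diag {n : ℕ} (M : Matrix (Fin n) (Fin n) 𝕂) (a : Fin n) :
    (w0bar n 𝕂 * M * (w0bar n 𝕂)ᵀ) a a = M a.rev a.rev := by
  rw [w0bar_conj_apply, mul_right_comm, neg_one_pow_mul_self, one_mul]

theorem w0bar_mul_transpose (n : ℕ) : w0bar n 𝕂 * (w0bar n 𝕂)ᵀ = 1 := by
  ext a b
  have h := w0bar_conj_apply (1 : Matrix (Fin n) (Fin n) 𝕂) a b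
  rw [mul_one] at h
  rw [h]
  by_cases hab : a = b
  · subst hab
    simp [neg_one_pow_mul_self]
  · simp [one_apply, hab]

theorem w0bar_transpose (n : ℕ) : (w0bar n 𝕂)ᵀ = (-1 : 𝕂) ^ (n - 1) • w0bar n 𝕂 := by
  ext a b
  simp only [transpose_apply, Matrix.smul_apply, w0bar, smul_eq_mul, mul_ite, mul_zero,
    add_comm (b : ℕ)]
  split_ifs with h
  · rw [show n - 1 - (b : ℕ) = a by omega, show n - 1 - (a : ℕ) = b by omega, ← h, pow_add,
      mul_assoc, neg_one_pow_mul_self, mul_one]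
  · rfl

theorem det_w0bar (n : ℕ) : (w0bar n 𝕂).det = 1 := by
  induction n with
  | zero => simp
  | succ n ih =>
    rw [det_succ_row_zero, Finset.sum_eq_single (Fin.last n)]
    · have : (w0bar (n + 1) 𝕂).submatrix Fin.succ (Fin.last n).succAbove = w0bar n 𝕂 := by
        ext a b
        simp only [submatrix_apply, w0bar, Fin.succAbove_last, Fin.val_succ, Fin.val_castSucc]
        congr 1
        · apply propext
          omega
        · congr 1
          omega
      rw [this, ih]
      simp [w0bar_apply, neg_one_pow_mul_self]
    · intro b _ hb
      simp [w0bar_apply, hb]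
    · simp

theorem lowerLeft_w0bar {n k : ℕ} (hk : k ≤ n) : (w0bar n 𝕂).lowerLeft hk = w0bar k 𝕂 := by
  ext a b
  simp only [lowerLeft, submatrix_apply, w0bar, Fin.val_rev, Fin.val_castLE]
  congr 1
  · apply propext
    omega
  · congr 1
    omega

end Longest

section NegativeWord

variable {𝕂 : Type*} [Field 𝕂]

/-- The product of the matrices `xNegMat n 𝕂 i (z t)`, `i` the `t`-th letter of a word. -/
noncomputable def xNegProd (n : ℕ) (l : List ℕ) (z : ℕ → 𝕂) : Matrix (Fin n) (Fin n) 𝕂 :=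
  ((List.range l.length).map fun t => xNegMat n 𝕂 (l.getD t 0) (z (t + 1))).prod

theorem xNegProd_append (n : ℕ) (l₁ l₂ : List ℕ) (z : ℕ → 𝕂) :
    xNegProd n (l₁ ++ l₂) z
      = xNegProd n l₁ z * xNegProd n l₂ fun t => z (l₁.length + t) := by
  simp only [xNegProd, List.length_append, List.range_add, List.map_append, List.prod_append,
    List.map_map]
  congr 2
  · refine List.map_congr_left fun t ht => ?_
    rw [List.getD_append _ _ _ _ (List.mem_range.1 ht)]
  · refine List.map_congr_left fun t _ => ?_
    simp only [Function.comp_apply, add_assoc]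
    rw [List.getD_append_right _ _ _ _ (by omega), Nat.add_sub_cancel_left]

theorem xNegProd_nil (n : ℕ) (z : ℕ → 𝕂) : xNegProd n [] z = 1 := by
  simp [xNegProd]

theorem xNegProd_singleton (n i : ℕ) (z : ℕ → 𝕂) : xNegProd n [i] z = xNegMat n 𝕂 i (z 1) := by
  simp [xNegProd]

theorem xNegProd_cons (n i : ℕ) (l : List ℕ) (z : ℕ → 𝕂) :
    xNegProd n (i :: l) z = xNegMat n 𝕂 i (z 1) * xNegProd n l fun t => z (1 + t) := by
  rw [← List.singleton_append, xNegProd_append, xNegProd_singleton]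
  rfl

theorem xNegMat_lower (n i : ℕ) (z : 𝕂) :
    (xNegMat n 𝕂 i z).BlockTriangular OrderDual.toDual := by
  intro a b hab
  simp only [OrderDual.toDual_lt_toDual, Fin.lt_def] at hab
  simp only [xNegMat, Fin.ext_iff]
  rw [if_neg, if_neg, if_neg, if_neg] <;> omega

theorem xNegProd_lower (n : ℕ) (l : List ℕ) (z : ℕ → 𝕂) :
    (xNegProd n l z).BlockTriangular OrderDual.toDual := by
  induction l generalizing z with
  | nil => rw [xNegProd_nil]; exact blockTriangular_one
  | cons i l ih => rw [xNegProd_cons]; exact (xNegMat_lower n i _).mul (ih _)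

theorem det_xNegMat {n i : ℕ} (hi : 1 ≤ i) (hin : i < n) {z : 𝕂} (hz : z ≠ 0) :
    (xNegMat n 𝕂 i z).det = 1 := by
  have hdiag : ∀ a : Fin n, xNegMat n 𝕂 i z a a
      = (if a = ⟨i - 1, by omega⟩ then z⁻¹ else 1) * if a = ⟨i, hin⟩ then z else 1 := by
    intro a
    simp only [xNegMat, Fin.ext_iff]
    split_ifs <;> first | omega | simp
  rw [det_of_isLowerTriangular _ (xNegMat_lower n i z), Finset.prod_congr rfl fun a _ => hdiag a,
    Finset.prod_mul_distrib]
  simp [hz]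

theorem det_xNegProd {n : ℕ} {l : List ℕ} {z : ℕ → 𝕂} (hl : ∀ i ∈ l, 1 ≤ i ∧ i < n)
    (hz : ∀ t, 1 ≤ t → t ≤ l.length → z t ≠ 0) : (xNegProd n l z).det = 1 := by
  induction l generalizing z with
  | nil => simp [xNegProd_nil]
  | cons i l ih =>
    obtain ⟨h1, h2⟩ := hl i (by simp)
    rw [xNegProd_cons, det_mul, det_xNegMat h1 h2 (hz 1 le_rfl (by simp)),
      ih (fun j hj => hl j (by simp [hj])), one_mul]
    intro t ht htl
    exact hz _ (by omega) (by simp; omega)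

theorem xNegMat_succ_castSucc {n i : ℕ} (z : 𝕂) :
    (xNegMat (n + 1) 𝕂 i z).submatrix Fin.castSucc Fin.castSucc = xNegMat n 𝕂 i z := by
  ext a b
  simp [xNegMat]

theorem not_mem_range_castSucc {n : ℕ} {c : Fin (n + 1)}
    (hc : c ∉ Set.range (Fin.castSucc : Fin n → Fin (n + 1))) : c = Fin.last n := by
  by_contra h
  exact hc ⟨c.castPred h, by simp⟩

theorem xNegProd_succ_castSucc (n : ℕ) (l : List ℕ) (z : ℕ → 𝕂) :
    (xNegProd (n + 1) l z).submatrix Fin.castSucc Fin.castSucc = xNegProd n l z := by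
  induction l generalizing z with
  | nil =>
    rw [xNegProd_nil, xNegProd_nil]
    exact submatrix_one _ (Fin.castSucc_injective n)
  | cons i l ih =>
    rw [xNegProd_cons, xNegProd_cons,
      submatrix_mul_of_injective _ _ (Fin.castSucc_injective n), ih, xNegMat_succ_castSucc]
    intro a b c hc
    rw [not_mem_range_castSucc hc, xNegMat_lower, zero_mul]
    exact Fin.castSucc_lt_last a

theorem xNegProd_last_castSucc {n : ℕ} {l : List ℕ} (z : ℕ → 𝕂) (hl : ∀ i ∈ l, i < n)
    (b : Fin n) : xNegProd (n + 1) l z (Fin.last n) b.castSucc = 0 := by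
  induction l generalizing z with
  | nil => simp [xNegProd_nil, one_apply, (Fin.castSucc_lt_last b).ne']
  | cons i l ih =>
    rw [xNegProd_cons, mul_apply]
    refine Finset.sum_eq_zero fun c _ => ?_
    rcases Fin.eq_castSucc_or_eq_last c with ⟨c, rfl⟩ | rfl
    · have := hl i (by simp)
      have := c.isLt
      simp only [xNegMat, Fin.ext_iff, Fin.val_last, Fin.val_castSucc]
      rw [if_neg, if_neg, if_neg, if_neg, zero_mul] <;> omega
    · rw [ih _ fun j hj => hl j (by simp [hj]), mul_zero]

theorem xNegMat_row_eq_one {n i : ℕ} (z : 𝕂) {a : Fin n} (h : i < a) :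
    xNegMat n 𝕂 i z a = (1 : Matrix (Fin n) (Fin n) 𝕂) a := by
  ext b
  simp only [xNegMat, one_apply]
  rw [if_neg (by omega), if_neg (by omega), if_neg (by omega)]

theorem xNegMat_apply_of_col_lt {n i : ℕ} (z : 𝕂) (a : Fin n) {b : Fin n} (h : (b : ℕ) + 1 < i) :
    xNegMat n 𝕂 i z a b = (1 : Matrix (Fin n) (Fin n) 𝕂) a b := by
  simp only [xNegMat, one_apply]
  rw [if_neg (by omega), if_neg (by omega), if_neg (by omega)]

theorem xNegProd_row_eq_one {n t : ℕ} {l : List ℕ} (hl : ∀ i ∈ l, i ≤ t) (z : ℕ → 𝕂)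
    {a : Fin n} (h : t < a) : xNegProd n l z a = (1 : Matrix (Fin n) (Fin n) 𝕂) a := by
  induction l generalizing z with
  | nil => rw [xNegProd_nil]
  | cons i l ih =>
    ext b
    rw [xNegProd_cons, mul_apply, xNegMat_row_eq_one _ ((hl i (by simp)).trans_lt h)]
    simp only [one_apply, ite_mul, one_mul, zero_mul, Finset.sum_ite_eq, Finset.mem_univ, if_true]
    rw [ih fun j hj => hl j (by simp [hj]), one_apply]

/-- The product over the word `(1, …, t)` has ones on the first `t` places of the subdiagonal and
vanishes below it. -/
theorem xNegProd_range_apply {n : ℕ} (t : ℕ) (z : ℕ → 𝕂) {a b : Fin n} (hba : b < a) :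
    xNegProd n ((List.range t).map (· + 1)) z a b
      = if (b : ℕ) + 1 = a ∧ (a : ℕ) ≤ t then 1 else 0 := by
  rw [Fin.lt_def] at hba
  induction t with
  | zero =>
    simp only [List.range_zero, List.map_nil, xNegProd_nil, one_apply, Fin.ext_iff]
    rw [if_neg, if_neg] <;> omega
  | succ t ih =>
    simp only [List.range_succ, List.map_append, List.map_cons, List.map_nil, xNegProd_append,
      xNegProd_singleton, mul_apply]
    rcases le_or_gt (a : ℕ) t with hat | hat
    · have hbt : (b : ℕ) + 1 < t + 1 := by omega
      simp only [xNegMat_apply_of_col_lt _ _ hbt, one_apply, mul_ite, mul_one, mul_zero,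
        Finset.sum_ite_eq', Finset.mem_univ, if_true, ih, hat, Nat.le_succ_of_le hat]
    · rw [xNegProd_row_eq_one (t := t) _ z hat]
      · simp only [one_apply, ite_mul, one_mul, zero_mul, Finset.sum_ite_eq, Finset.mem_univ,
          if_true]
        simp only [xNegMat, Fin.ext_iff]
        split_ifs <;> first | rfl | omega
      · simp only [List.mem_map, List.mem_range]
        omega

theorem wordI0_succ (n : ℕ) : wordI0 (n + 1) = (List.range n).map (· + 1) ++ wordI0 n := by
  cases n with
  | zero => rfl
  | succ n =>
    simp only [wordI0, Nat.add_sub_cancel, List.range_succ_eq_map (n := n), List.flatMap_cons,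
      List.flatMap_map, Nat.sub_zero]
    simp only [Nat.succ_eq_add_one, ← Nat.sub_sub, Nat.sub_right_comm _ _ 1,
      Nat.add_sub_cancel]

theorem mem_wordI0 {n i : ℕ} (hi : i ∈ wordI0 n) : 1 ≤ i ∧ i < n := by
  simp only [wordI0, List.mem_flatMap, List.mem_map, List.mem_range] at hi
  omega

theorem length_wordI0 (n : ℕ) : (wordI0 n).length = n * (n - 1) / 2 := by
  rw [← Nat.choose_two_right]
  induction n with
  | zero => rfl
  | succ n ih => simp [wordI0_succ, ih, Nat.choose_succ_succ']

/-- All lower left minors of the product over the word `wordI0 n` are one. -/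
theorem det_lowerLeft_xNegProd_wordI0 {n : ℕ} {z : ℕ → 𝕂}
    (hz : ∀ t, 1 ≤ t → t ≤ (wordI0 n).length → z t ≠ 0) {k : ℕ} (hk : k ≤ n) :
    ((xNegProd n (wordI0 n) z).lowerLeft hk).det = 1 := by
  induction n generalizing z k with
  | zero =>
    obtain rfl : k = 0 := by omega
    simp
  | succ n ih =>
    rcases Nat.le_succ_iff.1 hk with hkn | rfl
    · set z' : ℕ → 𝕂 := fun t => z (((List.range n).map (· + 1)).length + t)
      have hsub : (xNegProd (n + 1) (wordI0 (n + 1)) z).submatrix Fin.succ Fin.castSucc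
          = (xNegProd (n + 1) ((List.range n).map (· + 1)) z).submatrix Fin.succ Fin.castSucc
            * xNegProd n (wordI0 n) z' := by
        rw [wordI0_succ, xNegProd_append,
          submatrix_mul_of_injective _ _ (Fin.castSucc_injective n), xNegProd_succ_castSucc]
        intro a b c hc
        rw [not_mem_range_castSucc hc, xNegProd_last_castSucc _ fun i hi => (mem_wordI0 hi).2,
          mul_zero]
      have hll : (xNegProd (n + 1) (wordI0 (n + 1)) z).lowerLeft hk
          = ((xNegProd (n + 1) (wordI0 (n + 1)) z).submatrix Fin.succ Fin.castSucc).lowerLeft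
            hkn := by
        ext a b
        have ha : (Fin.castLE hk a.rev).rev = (Fin.castLE hkn a.rev).rev.succ := by
          ext
          simp only [Fin.val_rev, Fin.val_castLE, Fin.val_succ]
          omega
        simp only [lowerLeft, submatrix_apply, ha]
        rfl
      rw [hll, hsub, det_lowerLeft_upper_mul, ih]
      · intro t ht htl
        refine hz _ (by omega) ?_
        rw [wordI0_succ, List.length_append]
        omega
      · intro a b hba
        simp only [id, Fin.lt_def] at hba
        rw [submatrix_apply, xNegProd_range_apply, if_neg]
        · simp only [Fin.val_succ, Fin.val_castSucc]
          omega
        · simp only [Fin.lt_def, Fin.val_succ, Fin.val_castSucc]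
          omega
      · intro a
        rw [submatrix_apply, xNegProd_range_apply _ _ Fin.castSucc_lt_succ, if_pos]
        exact ⟨rfl, a.isLt⟩
    · have hll : (xNegProd (n + 1) (wordI0 (n + 1)) z).lowerLeft hk
          = xNegProd (n + 1) (wordI0 (n + 1)) z := by
        ext a b
        simp only [lowerLeft, submatrix_apply]
        congr 1
        simp
      rw [hll]
      exact det_xNegProd (fun i hi => mem_wordI0 hi) hz

end NegativeWord

/-- If the leading partial products of a family are all one, so are its members. -/
theorem eq_one_of_prod_castLE_eq_one {M : Type*} [CommMonoid M] {n : ℕ} {f : Fin n → M}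
    (h : ∀ k (hk : k ≤ n), ∏ i : Fin k, f (Fin.castLE hk i) = 1) (i : Fin n) : f i = 1 := by
  have h₁ := h (i + 1) i.isLt
  rw [Fin.prod_univ_castSucc] at h₁
  have h₂ := h i i.isLt.le
  simp only [Fin.castLE_castSucc] at h₁
  rwa [h₂, one_mul] at h₁

/-- with b = u₁·d·w̄₀·u₂ lower triangular and invertible and b = [b]₋·t_R,
the diagonal matrix t_R satisfies t_R = w̄₀·d·[u]₀·w̄₀⁻¹; equivalently
b_{n+1−j,n+1−j} = d_{jj}·u_{jj} for every 1 ≤ j ≤ n. -/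
theorem stmt3
    (𝕂 : Type*) [Field 𝕂]
    (n N : ℕ) (hn : 2 ≤ n) (hN : N = n * (n - 1) / 2)
    (z : ℕ → 𝕂) (hz : ∀ j, 1 ≤ j → j ≤ N → z j ≠ 0)
    (u : Matrix (Fin n) (Fin n) 𝕂)
    (hu : u = ((List.range N).map
      (fun t => xNegMat n 𝕂 ((wordI0 n).getD t 0) (z (t + 1)))).prod)
    (L D U : Matrix (Fin n) (Fin n) 𝕂)
    (hL : ∀ a b : Fin n, a < b → L a b = 0) (hLdiag : ∀ a : Fin n, L a a = 1)
    (hD : ∀ a b : Fin n, a ≠ b → D a b = 0) (hDinv : ∀ a : Fin n, D a a ≠ 0)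
    (hU : ∀ a b : Fin n, b < a → U a b = 0) (hUdiag : ∀ a : Fin n, U a a = 1)
    (hLDU : (w0bar n 𝕂 * u.transpose)⁻¹ = L * D * U)
    (u₁ : Matrix (Fin n) (Fin n) 𝕂)
    (hu₁ : u₁ = (w0bar n 𝕂 * U⁻¹ * (w0bar n 𝕂)⁻¹).transpose)
    (d : Matrix (Fin n) (Fin n) 𝕂)
    (hd : ∀ a b : Fin n, a ≠ b → d a b = 0) (hdinv : ∀ a : Fin n, d a a ≠ 0)
    (u₂ : Matrix (Fin n) (Fin n) 𝕂)
    (hu₂ : ∀ a b : Fin n, b < a → u₂ a b = 0) (hu₂diag : ∀ a : Fin n, u₂ a a = 1)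
    (b : Matrix (Fin n) (Fin n) 𝕂)
    (hb : b = u₁ * d * w0bar n 𝕂 * u₂)
    (hblower : ∀ p q : Fin n, p < q → b p q = 0)
    (hbinv : IsUnit b.det) :
    ∀ j : Fin n, b j.rev j.rev = d j j * u j j := by
  set W := w0bar n 𝕂 with hW
  have hlen : (wordI0 n).length = N := by rw [length_wordI0, hN]
  replace hu : u = xNegProd n (wordI0 n) z := by rw [hu, xNegProd, hlen]
  have hz' : ∀ t, 1 ≤ t → t ≤ (wordI0 n).length → z t ≠ 0 := by rwa [hlen]
  have hminor : ∀ k (hk : k ≤ n), (u.lowerLeft hk).det = 1 := fun k hk => by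
    rw [hu, det_lowerLeft_xNegProd_wordI0 hz']
  have hulow : u.BlockTriangular OrderDual.toDual := hu ▸ xNegProd_lower n _ z
  have hudet : u.det = 1 := by rw [hu, det_xNegProd (fun i hi => mem_wordI0 hi) hz']
  have hWW : W * Wᵀ = 1 := w0bar_mul_transpose n
  have hWW' : Wᵀ * W = 1 := mul_eq_one_comm.1 hWW
  have hWT : Wᵀ = (-1 : 𝕂) ^ (n - 1) • W := w0bar_transpose n
  have hWTT : Wᵀ * Wᵀ = (-1 : 𝕂) ^ (n - 1) • 1 := by
    nth_rw 1 [hWT]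
    rw [smul_mul, hWW]
  have hinv : W * uᵀ * (L * D * U) = 1 := by
    rw [← hLDU]
    refine mul_nonsing_inv _ ?_
    rw [det_mul, det_transpose, hudet, mul_one, hW, det_w0bar]
    exact isUnit_one
  have hDup : D.BlockTriangular id := fun a c hac => hD a c (ne_of_gt hac)
  have hLup : Lᵀ.BlockTriangular id := fun a c hac => hL c a hac
  -- The diagonal factor of the decomposition is trivial.
  have hfac : Lᵀ * (u * (W * (D * U)ᵀ * Wᵀ)) = W := by
    have h := congrArg transpose hinv
    rw [transpose_one, Matrix.mul_assoc L, transpose_mul, transpose_mul L, transpose_mul W,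
      transpose_transpose, Matrix.mul_assoc, mul_eq_one_comm, Matrix.mul_assoc] at h
    have hWX : W * (D * U)ᵀ * Wᵀ = Wᵀ * (D * U)ᵀ * W := by
      rw [hWT, Matrix.mul_smul, smul_mul, smul_mul]
    rw [hWX]
    simpa only [Matrix.mul_assoc, Matrix.one_mul] using congrArg (· * W) h
  have hDU : (D * U).BlockTriangular id := hDup.mul hU
  have hconj : (W * (D * U)ᵀ * Wᵀ).BlockTriangular id := fun a c hac => by
    rw [w0bar_conj_apply, transpose_apply, hDU (by simpa using hac), mul_zero, zero_mul]
  have hD1 : ∀ a, D a a = 1 := fun a => by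
    rw [← Fin.rev_rev a]
    refine eq_one_of_prod_castLE_eq_one (f := fun i : Fin n => D i.rev i.rev) (fun k hk => ?_) _
    have h := congrArg (fun M => (lowerLeft M hk).det) hfac
    simp only [det_lowerLeft_upper_mul hLup hLdiag, det_lowerLeft_mul_upper _ hconj, hminor,
      one_mul] at h
    simpa only [hW, lowerLeft_w0bar, det_w0bar, w0bar_conj_apply_diag, transpose_apply,
      hDup.mul_apply_diag Function.injective_id hU, hUdiag, mul_one] using h
  have hD_one : D = 1 := by
    ext a c
    by_cases hac : a = c
    · rw [hac, hD1, one_apply_eq]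
    · rw [hD a c hac, one_apply_ne hac]
  rw [hD_one, Matrix.mul_one] at hinv
  have hUinv : U⁻¹ = W * uᵀ * L := by
    rw [← Matrix.mul_assoc] at hinv
    exact inv_eq_left_inv hinv
  have hkey : W * b * Wᵀ = Lᵀ * (u * d * (W * u₂ * Wᵀ)) := by
    have hWinv : W⁻¹ = Wᵀ := inv_eq_right_inv hWW
    have hWu : W * u₁ = (-1 : 𝕂) ^ (n - 1) • (W * W * Lᵀ * u) := by
      rw [hu₁, hUinv, hWinv]
      simp only [transpose_mul, transpose_transpose, Matrix.mul_assoc, hWTT, Matrix.mul_smul,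
        Matrix.mul_one]
    have hWW2 : (-1 : 𝕂) ^ (n - 1) • (W * W) = 1 := by
      rw [← smul_mul, ← hWT, hWW']
    rw [← smul_mul, ← smul_mul, hWW2, Matrix.one_mul] at hWu
    rw [hb]
    simp only [← Matrix.mul_assoc, hWu]
  have hdlow : d.BlockTriangular OrderDual.toDual := fun a c hac => hd a c (ne_of_lt hac)
  have hu₂low : (W * u₂ * Wᵀ).BlockTriangular OrderDual.toDual := fun a c hac => by
    rw [w0bar_conj_apply, hu₂ _ _ (by simpa using hac), mul_zero, zero_mul]
  have hWb : (W * b * Wᵀ).BlockTriangular id := fun a c hac => by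
    rw [w0bar_conj_apply, hblower _ _ (by simpa using hac), mul_zero, zero_mul]
  have hLdet : IsUnit Lᵀ.det := by
    rw [det_of_isUpperTriangular hLup]
    simp [hLdiag]
  intro j
  have hdiag := (hkey ▸ hWb).mul_lower_apply_diag hLup hLdet j
  have hinj := OrderDual.toDual.injective (α := Fin n)
  rw [← hkey, w0bar_conj_apply_diag, (hulow.mul hdlow).mul_apply_diag hinj hu₂low,
    hulow.mul_apply_diag hinj hdlow, w0bar_conj_apply_diag, hu₂diag,
    transpose_apply, hLdiag] at hdiag
  rw [hdiag, one_mul, mul_one, mul_comm]
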